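/- Let E be a complex Hilbert space and N ≥ 1. For W ∈ G_N(E) write Z = C^{-1}(W) ∈ B_N(E) (so Z_k = 2i(iI+W_N)^{-1}W_k for 1 ≤ k ≤ N−1 and Z_N = (iI+W_N)^{-1}(iI−W_N)). (i) For all W, W' ∈ G_N(E) and all e, f ∈ E, the family (4·⟨((iI+W'_N)^{-1})^*·(Z'_σ)^* f, ((iI+W_N)^{-1})^*·(Z_σ)^* e⟩)_{σ∈F_N^+} is summable; denote its sum by ⟨K_G(W,W')f, e⟩. (ii) The Szegő kernel K_G is positive definite on G_N(E): for every m ≥ 1, all W^1,…,W^m ∈ G_N(E), and all e_1,…,e_m ∈ E, the number Σ_{i,j=1}^m ⟨K_G(W^i,W^j) e_j, e_i⟩ is a nonnegative real. -/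

import Mathlib

noncomputable section
open scoped InnerProductSpace ComplexConjugate
open ContinuousLinearMap

/-- Words in `N` letters: the free monoid `F_N^+` on `N` generators. -/
abbrev Word (N : ℕ) := FreeMonoid (Fin N)

variable {E : Type*} [NormedAddCommGroup E] [InnerProductSpace ℂ E] [CompleteSpace E]

/-- The word product `Z_σ = Z_{i_1} ⋯ Z_{i_k}` for `σ = i_1 ⋯ i_k`, with `Z_∅ = I`. -/
def wprod {N : ℕ} (Z : Fin N → E →L[ℂ] E) (σ : Word N) : E →L[ℂ] E :=
  ((FreeMonoid.toList σ).map Z).prod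

/-- Membership in the open operator unit ball `B_N(E)`:
`I − Σ_k Z_k Z_k^*` is positive and invertible. -/
def inBall {N : ℕ} (Z : Fin N → E →L[ℂ] E) : Prop :=
  (1 - ∑ k, Z k * adjoint (Z k)).IsPositive ∧ IsUnit (1 - ∑ k, Z k * adjoint (Z k))

/-- Membership in the Siegel upper half-space `G_N(E)` (here `N = n+1`):
`(1/(2i))(W_N − W_N^*) − Σ_{k=1}^{N−1} W_k W_k^*` is positive and invertible. -/
def inSiegel {n : ℕ} (W : Fin (n + 1) → E →L[ℂ] E) : Prop :=
  ((2 * Complex.I)⁻¹ • (W (Fin.last n) - adjoint (W (Fin.last n))) -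
      ∑ k : Fin n, W k.castSucc * adjoint (W k.castSucc)).IsPositive ∧
  IsUnit ((2 * Complex.I)⁻¹ • (W (Fin.last n) - adjoint (W (Fin.last n))) -
      ∑ k : Fin n, W k.castSucc * adjoint (W k.castSucc))

/-- The Cayley transform
`C(Z) = ((I+Z_N)⁻¹Z_1, …, (I+Z_N)⁻¹Z_{N−1}, i(I+Z_N)⁻¹(I−Z_N))`. -/
def cayley {n : ℕ} (Z : Fin (n + 1) → E →L[ℂ] E) : Fin (n + 1) → E →L[ℂ] E := fun k =>
  if k = Fin.last n then
    Complex.I • (Ring.inverse (1 + Z (Fin.last n)) * (1 - Z (Fin.last n)))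
  else Ring.inverse (1 + Z (Fin.last n)) * Z k

/-- The inverse Cayley transform
`C⁻¹(W) = (2i(iI+W_N)⁻¹W_1, …, 2i(iI+W_N)⁻¹W_{N−1}, (iI+W_N)⁻¹(iI−W_N))`. -/
def cayleyInv {n : ℕ} (W : Fin (n + 1) → E →L[ℂ] E) : Fin (n + 1) → E →L[ℂ] E := fun k =>
  if k = Fin.last n then
    Ring.inverse (Complex.I • 1 + W (Fin.last n)) * (Complex.I • 1 - W (Fin.last n))
  else (2 * Complex.I) • (Ring.inverse (Complex.I • 1 + W (Fin.last n)) * W k)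

/-- Finite exhausting sets of words. -/
def wordsLT (N : ℕ) : ℕ → Finset (List (Fin N))
  | 0 => ∅
  | k + 1 => insert [] (Finset.univ.biUnion fun i => (wordsLT N k).image (List.cons i))

lemma mem_wordsLT {N : ℕ} (k : ℕ) (l : List (Fin N)) (h : l.length < k) : l ∈ wordsLT N k := by
  induction k generalizing l with
  | zero => simp at h
  | succ k ih =>
    cases l with
    | nil => simp [wordsLT]
    | cons a t =>
      have := ih t (by simpa using h)
      simp [wordsLT, this]

lemma sum_wordsLT_succ_le {N : ℕ} (k : ℕ) (g : List (Fin N) → ℝ) (hg : ∀ l, 0 ≤ g l) :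
    ∑ l ∈ wordsLT N (k + 1), g l ≤ g [] + ∑ i, ∑ l ∈ wordsLT N k, g (i :: l) := by
  rw [wordsLT, Finset.sum_insert (by simp)]
  gcongr
  rw [Finset.sum_biUnion]
  · refine Finset.sum_le_sum fun i _ => ?_
    rw [Finset.sum_image]
    intro a _ b _ h
    simpa using h
  · intro i _ j _ hij
    rw [Function.onFun, Finset.disjoint_left]
    intro a ha hb
    simp only [Finset.mem_image] at ha hb
    obtain ⟨u, _, rfl⟩ := ha
    obtain ⟨v, _, h⟩ := hb
    simp at h
    exact hij h.1.symm

lemma sum_bound {N : ℕ} (Z : Fin N → E →L[ℂ] E) (T : E →L[ℂ] E) (c : ℝ) (hc : 0 ≤ c)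
    (h : ∀ x, c * ‖T x‖ ^ 2 + ∑ i, ‖adjoint (Z i) x‖ ^ 2 ≤ ‖x‖ ^ 2) (k : ℕ) (x : E) :
    ∑ l ∈ wordsLT N k, c * ‖T (adjoint ((l.map Z).prod) x)‖ ^ 2 ≤ ‖x‖ ^ 2 := by
  induction k generalizing x with
  | zero => simp [wordsLT]
  | succ k ih =>
    refine (sum_wordsLT_succ_le k _ (fun l => by positivity)).trans ?_
    refine le_trans ?_ (h x)
    gcongr with i
    · simp [← star_eq_adjoint]
    · refine le_trans (le_of_eq ?_) (ih (adjoint (Z i) x))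
      refine Finset.sum_congr rfl fun l _ => ?_
      simp [← star_eq_adjoint]

lemma summable_sq {N : ℕ} (Z : Fin N → E →L[ℂ] E) (T : E →L[ℂ] E) (c : ℝ) (hc : 0 < c)
    (h : ∀ x, c * ‖T x‖ ^ 2 + ∑ i, ‖adjoint (Z i) x‖ ^ 2 ≤ ‖x‖ ^ 2) (x : E) :
    Summable fun σ : Word N => ‖T (adjoint (wprod Z σ) x)‖ ^ 2 := by
  have key : Summable fun l : List (Fin N) => c * ‖T (adjoint ((l.map Z).prod) x)‖ ^ 2 := by
    refine summable_of_sum_le (c := ‖x‖ ^ 2) (fun l => by positivity) fun u => ?_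
    refine le_trans ?_ (sum_bound Z T c hc.le h (u.sup List.length + 1) x)
    refine Finset.sum_le_sum_of_subset_of_nonneg (fun l hl => ?_) (fun l _ _ => by positivity)
    exact mem_wordsLT _ _ (Nat.lt_succ_of_le (Finset.le_sup (f := List.length) hl))
  exact (summable_mul_left_iff hc.ne').1 key

lemma pos_lower (D : E →L[ℂ] E) (hD : D.IsPositive) (hu : IsUnit D) :
    ∃ c : ℝ, 0 < c ∧ ∀ x, c * ‖x‖ ^ 2 ≤ (⟪D x, x⟫_ℂ).re := by
  obtain hE | hE := subsingleton_or_nontrivial E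
  · exact ⟨1, one_pos, fun x => by simp [Subsingleton.elim x 0]⟩
  have hD0 : 0 ≤ D := (nonneg_iff_isPositive D).2 hD
  have hsp : IsStrictlyPositive D := ⟨hD0, hu⟩
  obtain ⟨r, hr, hle⟩ : ∃ r > 0, (algebraMap ℝ (E →L[ℂ] E)) r ≤ D :=
    (CFC.exists_pos_algebraMap_le_iff hsp.isSelfAdjoint).2 fun x hx => hsp.spectrum_pos hx
  refine ⟨r, hr, fun x => ?_⟩
  have := ((le_def _ _).1 hle).re_inner_nonneg_left x
  have h2 : (algebraMap ℝ (E →L[ℂ] E) r) x = (r : ℂ) • x := by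
    rw [Algebra.algebraMap_eq_smul_one]
    simp
  rw [sub_apply, inner_sub_left, h2, inner_smul_left, inner_self_eq_norm_sq_to_K] at this
  have h3 : ((conj (r : ℂ) * ((‖x‖ : ℝ) : ℂ) ^ 2)).re = r * ‖x‖ ^ 2 := by
    rw [Complex.conj_ofReal]
    norm_cast
  have h4 : 0 ≤ (⟪D x, x⟫_ℂ - conj (r : ℂ) * ((‖x‖ : ℝ) : ℂ) ^ 2).re := this
  rw [Complex.sub_re, h3] at h4
  linarith

lemma siegel_ineq {n : ℕ} (W : Fin (n + 1) → E →L[ℂ] E) (hW : inSiegel W)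
    (hA : IsUnit (Complex.I • (1 : E →L[ℂ] E) + W (Fin.last n))) :
    ∃ c : ℝ, 0 < c ∧ ∀ x,
      c * ‖adjoint (Ring.inverse (Complex.I • (1 : E →L[ℂ] E) + W (Fin.last n))) x‖ ^ 2 +
        ∑ i, ‖adjoint (cayleyInv W i) x‖ ^ 2 ≤ ‖x‖ ^ 2 := by
  obtain ⟨c, hc, hD⟩ := pos_lower _ hW.1 hW.2
  refine ⟨4 * c, by positivity, fun x => ?_⟩
  set R := Ring.inverse (Complex.I • (1 : E →L[ℂ] E) + W (Fin.last n)) with hR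
  set A := Complex.I • (1 : E →L[ℂ] E) + W (Fin.last n) with hAdef
  set y := adjoint R x with hy
  have hx : x = adjoint A y := by
    have h1 : R * A = 1 := Ring.inverse_mul_cancel _ hA
    have h2 : star A * star R = 1 := by rw [← star_mul, h1, star_one]
    have := congrArg (fun f : E →L[ℂ] E => f x) h2
    simpa [star_eq_adjoint] using this.symm
  have hAy : x = -(Complex.I • y) + adjoint (W (Fin.last n)) y := by
    rw [hx, hAdef]
    simp [← star_eq_adjoint, star_add, star_smul]
  have hlast : adjoint (cayleyInv W (Fin.last n)) x
      = -(Complex.I • y) - adjoint (W (Fin.last n)) y := by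
    simp [cayleyInv, ← hR, ← hAdef, hy, ← star_eq_adjoint, star_sub, star_smul]
  have hk : ∀ k : Fin n, ‖adjoint (cayleyInv W k.castSucc) x‖ ^ 2
      = 4 * ‖adjoint (W k.castSucc) y‖ ^ 2 := by
    intro k
    have : adjoint (cayleyInv W k.castSucc) x = (-(2 * Complex.I)) • adjoint (W k.castSucc) y := by
      simp [cayleyInv, ← hR, ← hAdef, hy, ← star_eq_adjoint, star_smul, (Fin.castSucc_lt_last k).ne]
    rw [this, norm_smul, mul_pow]
    norm_num
  have hsum : (⟪(∑ k : Fin n, W k.castSucc * adjoint (W k.castSucc)) y, y⟫_ℂ).re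
      = ∑ k : Fin n, ‖adjoint (W k.castSucc) y‖ ^ 2 := by
    simp only [sum_apply, sum_inner, Complex.re_sum]
    refine Finset.sum_congr rfl fun k _ => ?_
    rw [mul_def, comp_apply, ← adjoint_inner_right, inner_self_eq_norm_sq_to_K]
    norm_cast
  have hDy := hD y
  rw [sub_apply, inner_sub_left, Complex.sub_re, hsum] at hDy
  rw [Fin.sum_univ_castSucc, hlast]
  simp only [hk, ← Finset.mul_sum]
  have hid : ‖x‖ ^ 2 - ‖-(Complex.I • y) - adjoint (W (Fin.last n)) y‖ ^ 2
      = 4 * (⟪((2 * Complex.I)⁻¹ • (W (Fin.last n) - adjoint (W (Fin.last n)))) y, y⟫_ℂ).re := by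
    set v := adjoint (W (Fin.last n)) y with hv
    have hw : ⟪W (Fin.last n) y, y⟫_ℂ = ⟪y, v⟫_ℂ := (adjoint_inner_right (W (Fin.last n)) y y).symm
    have hvy : ⟪v, y⟫_ℂ = conj ⟪y, v⟫_ℂ := (inner_conj_symm _ _).symm
    rw [hAy, @norm_add_sq ℂ, @norm_sub_sq ℂ, smul_apply, sub_apply, ← hv, inner_smul_left,
      inner_sub_left, hw, inner_neg_left, inner_smul_left]
    have him : (⟪v, y⟫_ℂ).im = -(⟪y, v⟫_ℂ).im := by rw [hvy, Complex.conj_im]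
    simp [him]
    ring
  linarith

lemma siegel_summable {n : ℕ} (W : Fin (n + 1) → E →L[ℂ] E) (hW : inSiegel W) (x : E) :
    Summable fun σ : Word (n + 1) =>
      ‖adjoint (Ring.inverse (Complex.I • (1 : E →L[ℂ] E) + W (Fin.last n)))
        (adjoint (wprod (cayleyInv W) σ) x)‖ ^ 2 := by
  by_cases hA : IsUnit (Complex.I • (1 : E →L[ℂ] E) + W (Fin.last n))
  · obtain ⟨c, hc, h⟩ := siegel_ineq W hW hA
    exact summable_sq _ _ c hc h x
  · simp [Ring.inverse_non_unit _ hA, summable_zero]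

lemma summable_inner_aux {ι : Type*} (u v : ι → E) (hu : Summable fun i => ‖u i‖ ^ 2)
    (hv : Summable fun i => ‖v i‖ ^ 2) : Summable fun i => 4 * ⟪u i, v i⟫_ℂ := by
  refine Summable.mul_left _ (Summable.of_norm_bounded (hu.add hv) fun i => ?_)
  have := norm_inner_le_norm (𝕜 := ℂ) (u i) (v i)
  nlinarith [sq_nonneg (‖u i‖ - ‖v i‖), sq_nonneg (‖u i‖ + ‖v i‖)]

lemma pd_aux {ι : Type*} {m : ℕ} (v : Fin m → ι → E) (hv : ∀ i, Summable fun s => ‖v i s‖ ^ 2) :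
    ∃ r : ℝ, 0 ≤ r ∧ ∑ i, ∑ j, ∑' s, 4 * ⟪v i s, v j s⟫_ℂ = (r : ℂ) := by
  refine ⟨∑' s, 4 * ‖∑ i, v i s‖ ^ 2, tsum_nonneg fun s => by positivity, ?_⟩
  have hs := fun i j => summable_inner_aux (v i) (v j) (hv i) (hv j)
  rw [Complex.ofReal_tsum]
  simp_rw [← Summable.tsum_finsetSum (fun j _ => hs _ j)]
  rw [← Summable.tsum_finsetSum (fun i _ => summable_sum fun j _ => hs i j)]
  refine tsum_congr fun s => ?_
  simp_rw [← Finset.mul_sum, ← inner_sum, ← sum_inner]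
  rw [inner_self_eq_norm_sq_to_K]
  push_cast
  rfl

/-- Lemma 4.3(a): (i) the matrix coefficients of the Szegő kernel
`K_G(W,W') = 4·Σ_σ Z_σ (iI+W_N)⁻¹ ((iI+W'_N)⁻¹)^* (Z'_σ)^*` of the Siegel upper
half-space (where `Z = C⁻¹(W)`, `Z' = C⁻¹(W')`) are given by summable families, and
(ii) `K_G` is a positive definite kernel on `G_N(E)`. Here the inner product
`⟨u, v⟩` linear in `u` is written as `⟪v, u⟫_ℂ` in Mathlib's convention. -/
theorem stmt15 {E : Type*} [NormedAddCommGroup E] [InnerProductSpace ℂ E] [CompleteSpace E]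
    {n : ℕ} :
    (∀ W W' : Fin (n + 1) → E →L[ℂ] E, inSiegel W → inSiegel W' → ∀ e f : E,
      Summable fun σ : Word (n + 1) =>
        4 * ⟪adjoint (Ring.inverse (Complex.I • (1 : E →L[ℂ] E) + W (Fin.last n)))
              (adjoint (wprod (cayleyInv W) σ) e),
            adjoint (Ring.inverse (Complex.I • (1 : E →L[ℂ] E) + W' (Fin.last n)))
              (adjoint (wprod (cayleyInv W') σ) f)⟫_ℂ) ∧
    (∀ (m : ℕ) (W : Fin m → Fin (n + 1) → E →L[ℂ] E), (∀ i, inSiegel (W i)) →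
      ∀ e : Fin m → E,
      (∑ i, ∑ j, ∑' σ : Word (n + 1),
          4 * ⟪adjoint (Ring.inverse (Complex.I • (1 : E →L[ℂ] E) + W i (Fin.last n)))
                (adjoint (wprod (cayleyInv (W i)) σ) (e i)),
              adjoint (Ring.inverse (Complex.I • (1 : E →L[ℂ] E) + W j (Fin.last n)))
                (adjoint (wprod (cayleyInv (W j)) σ) (e j))⟫_ℂ).im = 0 ∧
      0 ≤ (∑ i, ∑ j, ∑' σ : Word (n + 1),
          4 * ⟪adjoint (Ring.inverse (Complex.I • (1 : E →L[ℂ] E) + W i (Fin.last n)))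
                (adjoint (wprod (cayleyInv (W i)) σ) (e i)),
              adjoint (Ring.inverse (Complex.I • (1 : E →L[ℂ] E) + W j (Fin.last n)))
                (adjoint (wprod (cayleyInv (W j)) σ) (e j))⟫_ℂ).re) := by
  refine ⟨fun W W' hW hW' e f => ?_, fun m W hW e => ?_⟩
  · exact summable_inner_aux _ _ (siegel_summable W hW e) (siegel_summable W' hW' f)
  · obtain ⟨r, hr, h⟩ := pd_aux (fun i (σ : Word (n + 1)) =>
      adjoint (Ring.inverse (Complex.I • (1 : E →L[ℂ] E) + W i (Fin.last n)))
        (adjoint (wprod (cayleyInv (W i)) σ) (e i))) (fun i => siegel_summable (W i) (hW i) (e i))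
    rw [h]
    exact ⟨Complex.ofReal_im r, by simpa using hr⟩
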